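/- arXiv:2511.06543 — 2 statements merged into one kernel-verified Lean document; each statement's English description precedes it below -/
import Mathlib

section
/- There exists an infinite Blaschke product B such that the set {B(r) : r ∈ (0,1)} is dense in the closed unit disc; equivalently, B maps the radius from 0 to 1 onto a dense subset of the closed unit disc. -/
open Complex Metric MeasureTheory Filter Set

noncomputable section

/-- A finite Blaschke product: a unimodular constant times a finite product of
disc automorphisms `z ↦ (z - wₖ)/(1 - conj wₖ · z)` with `wₖ` in the open unit disc. -/
def IsFiniteBlaschke (B : ℂ → ℂ) : Prop :=
  ∃ (n : ℕ) (ζ : ℂ) (w : Fin (n + 1) → ℂ),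
    ‖ζ‖ = 1 ∧ (∀ k, ‖w k‖ < 1) ∧
    ∀ z : ℂ, B z = ζ * ∏ k, (z - w k) / (1 - (starRingEnd ℂ) (w k) * z)

/-- Arclength measure on the unit circle, viewed as a measure on `ℂ`. -/
def arclength : Measure ℂ :=
  Measure.map (circleMap 0 1) (volume.restrict (Set.Ioc 0 (2 * Real.pi)))

/-- An infinite Blaschke product: a convergent infinite product of rotated disc automorphisms
whose zeros satisfy the Blaschke condition. -/
def IsInfiniteBlaschke (B : ℂ → ℂ) : Prop :=
  ∃ (ζ : ℕ → ℂ) (w : ℕ → ℂ), (∀ k, ‖ζ k‖ = 1) ∧ (∀ k, ‖w k‖ < 1) ∧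
    Summable (fun k => 1 - ‖w k‖) ∧
    ∀ z ∈ Metric.ball (0:ℂ) 1,
      Tendsto (fun n => ∏ k ∈ Finset.range n,
          ζ k * (z - w k) / (1 - (starRingEnd ℂ) (w k) * z)) atTop (nhds (B z))

/-- The disc involution exchanging `0` and `w`. -/
def discInvolution (w z : ℂ) : ℂ :=
  (-1) * (z - w) / (1 - (starRingEnd ℂ) w * z)

lemma one_sub_conj_mul_ne_zero {w z : ℂ} (hw : ‖w‖ < 1) (hz : ‖z‖ ≤ 1) :
    1 - (starRingEnd ℂ) w * z ≠ 0 := by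
  intro h
  have h1 : ‖(starRingEnd ℂ) w * z‖ = 1 := by
    rw [← sub_eq_zero.mp h, norm_one]
  rw [norm_mul, RCLike.norm_conj] at h1
  nlinarith [norm_nonneg w, norm_nonneg z]

lemma norm_discInvolution_le_one {w z : ℂ} (hw : ‖w‖ < 1) (hz : ‖z‖ ≤ 1) :
    ‖discInvolution w z‖ ≤ 1 := by
  have h0 := one_sub_conj_mul_ne_zero hw hz
  rw [discInvolution, norm_div, div_le_one (norm_pos_iff.mpr h0), norm_mul, norm_neg, norm_one,
    one_mul]
  refine le_of_sq_le_sq ?_ (norm_nonneg _)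
  have hw2 : w.re * w.re + w.im * w.im ≤ 1 := by
    rw [← normSq_apply, normSq_eq_norm_sq]; nlinarith [norm_nonneg w]
  have hz2 : z.re * z.re + z.im * z.im ≤ 1 := by
    rw [← normSq_apply, normSq_eq_norm_sq]; nlinarith [norm_nonneg z]
  rw [← normSq_eq_norm_sq, ← normSq_eq_norm_sq, normSq_apply, normSq_apply]
  simp only [sub_re, sub_im, mul_re, mul_im, conj_re, conj_im, one_re, one_im]
  nlinarith [mul_nonneg (sub_nonneg.mpr hw2) (sub_nonneg.mpr hz2)]

lemma norm_discInvolution_one {w : ℂ} (hw : ‖w‖ < 1) : ‖discInvolution w 1‖ = 1 := by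
  have h0 := one_sub_conj_mul_ne_zero hw (z := 1) (by simp)
  have h : ‖1 - w‖ = ‖1 - (starRingEnd ℂ) w * 1‖ := by
    rw [← RCLike.norm_conj (1 - w)]; simp
  rw [discInvolution, norm_div, norm_mul, norm_neg, norm_one, one_mul, h,
    div_self (norm_ne_zero_iff.mpr h0)]

lemma norm_discInvolution_sub_one_le {w z : ℂ} (hw : ‖w‖ < 1) (hz : ‖z‖ < 1) :
    ‖discInvolution w z - 1‖ ≤ 2 * ‖1 - w‖ / (1 - ‖z‖) := by
  have h0 := one_sub_conj_mul_ne_zero hw hz.le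
  have h1 : discInvolution w z - 1 =
      -((1 - w) + z * (starRingEnd ℂ) (1 - w)) / (1 - (starRingEnd ℂ) w * z) := by
    rw [discInvolution, div_sub_one h0]
    congr 1
    simp only [map_sub, map_one]
    ring
  have h2 : 1 - ‖z‖ ≤ ‖1 - (starRingEnd ℂ) w * z‖ := by
    have := norm_sub_norm_le (1 : ℂ) ((starRingEnd ℂ) w * z)
    rw [norm_one, norm_mul, RCLike.norm_conj] at this
    nlinarith [norm_nonneg z]
  have h3 : ‖(1 - w) + z * (starRingEnd ℂ) (1 - w)‖ ≤ 2 * ‖1 - w‖ := by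
    refine (norm_add_le _ _).trans ?_
    rw [norm_mul, RCLike.norm_conj]
    nlinarith [norm_nonneg (1 - w)]
  rw [h1, norm_div, norm_neg]
  exact div_le_div₀ (by positivity) h3 (by linarith) h2

lemma continuousAt_discInvolution_one {w : ℂ} (hw : ‖w‖ < 1) :
    ContinuousAt (discInvolution w) 1 := by
  have h0 := one_sub_conj_mul_ne_zero hw (z := 1) (by simp)
  unfold discInvolution
  exact ContinuousAt.div (by fun_prop) (by fun_prop) h0

lemma exists_re_pos_div_eq {c : ℂ} (hc : ‖c‖ < 1) :
    ∃ v : ℂ, 0 < v.re ∧ (1 - v) / (1 + (starRingEnd ℂ) v) = c := by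
  have hpos : 0 < 1 - normSq c := by
    rw [normSq_eq_norm_sq]; nlinarith [norm_nonneg c]
  set v : ℂ := (1 - 2 * c + (normSq c : ℂ)) / ((1 - normSq c : ℝ) : ℂ) with hv
  have hre : 0 < v.re := by
    rw [hv, div_ofReal_re]
    refine div_pos ?_ hpos
    have : c.re < 1 := (re_le_norm c).trans_lt hc
    simp [normSq_apply]
    nlinarith [mul_pos (sub_pos.mpr this) (sub_pos.mpr this), mul_self_nonneg c.im]
  refine ⟨v, hre, ?_⟩
  have hne : 1 + (starRingEnd ℂ) v ≠ 0 := by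
    intro h
    have := congrArg re h
    simp at this
    linarith
  have hne' : ((1 - normSq c : ℝ) : ℂ) ≠ 0 := ofReal_ne_zero.mpr hpos.ne'
  rw [div_eq_iff hne, hv]
  simp only [map_div₀, conj_ofReal, map_add, map_sub, map_mul, map_one, map_ofNat]
  field_simp
  have := mul_conj c
  push_cast
  rw [← this]
  ring

lemma discInvolution_one_sub_mul {v : ℂ} {s : ℝ} (hs : s ≠ 0) :
    discInvolution (1 - s * v) ((1 - s : ℝ) : ℂ) =
      (1 - v) / (1 + (starRingEnd ℂ) v - s * (starRingEnd ℂ) v) := by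
  have hs' : (s : ℂ) ≠ 0 := ofReal_ne_zero.mpr hs
  rw [discInvolution, ← mul_div_mul_left (1 - v) _ hs']
  congr 1
  · push_cast; ring
  · simp only [map_sub, map_mul, map_one, conj_ofReal]; push_cast; ring

lemma eventually_norm_one_sub_mul_lt_one {v : ℂ} (hv : 0 < v.re) :
    ∀ᶠ s : ℝ in nhdsWithin 0 (Ioi 0), ‖1 - s * v‖ < 1 := by
  have hlim : Tendsto (fun s : ℝ => s * normSq v) (nhdsWithin 0 (Ioi 0)) (nhds 0) := by
    have : ContinuousAt (fun s : ℝ => s * normSq v) 0 := by fun_prop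
    simpa using this.tendsto.mono_left (nhdsWithin_le_nhds (s := Ioi 0))
  filter_upwards [self_mem_nhdsWithin, hlim.eventually_lt_const (show (0 : ℝ) < 2 * v.re by linarith)]
    with s hs hlt
  have hs : 0 < s := hs
  have h : ‖1 - s * v‖ ^ 2 < 1 ^ 2 := by
    rw [← normSq_eq_norm_sq, normSq_apply]
    rw [normSq_apply] at hlt
    simp
    nlinarith [mul_lt_mul_of_pos_left hlt hs]
  exact lt_of_pow_lt_pow_left₀ 2 (by norm_num) h

/-- One more factor brings the product close to a prescribed value at a point of the radius. -/
lemma exists_discInvolution_approx {P : ℂ → ℂ} (hP : ContinuousAt P 1) (hP1 : ‖P 1‖ = 1)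
    {c : ℂ} (hc : ‖c‖ < 1) {δ ε η : ℝ} (hδ : 0 < δ) (hε : 0 < ε) (hη : 0 < η) :
    ∃ (w : ℂ) (s : ℝ), ‖w‖ < 1 ∧ 0 < s ∧ s < δ ∧ ‖1 - w‖ < ε ∧
      dist (P ((1 - s : ℝ) : ℂ) * discInvolution w ((1 - s : ℝ) : ℂ)) c < η := by
  obtain ⟨v, hv, hvc⟩ := exists_re_pos_div_eq (c := c * (starRingEnd ℂ) (P 1))
    (by rwa [norm_mul, RCLike.norm_conj, hP1, mul_one])
  have hne : 1 + (starRingEnd ℂ) v ≠ 0 := by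
    intro h
    have := congrArg re h
    simp at this
    linarith
  have hle : nhdsWithin (0 : ℝ) (Ioi 0) ≤ nhds 0 := nhdsWithin_le_nhds
  have hPlim : Tendsto (fun s : ℝ => P ((1 - s : ℝ) : ℂ)) (nhds 0) (nhds (P 1)) := by
    refine hP.tendsto.comp ?_
    have : ContinuousAt (fun s : ℝ => ((1 - s : ℝ) : ℂ)) 0 := by fun_prop
    simpa using this.tendsto
  have hblim : Tendsto (fun s : ℝ => (1 - v) / (1 + (starRingEnd ℂ) v - s * (starRingEnd ℂ) v))
      (nhds 0) (nhds (c * (starRingEnd ℂ) (P 1))) := by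
    have : ContinuousAt
        (fun s : ℝ => (1 - v) / (1 + (starRingEnd ℂ) v - s * (starRingEnd ℂ) v)) 0 :=
      ContinuousAt.div (by fun_prop) (by fun_prop) (by simpa using hne)
    simpa [hvc] using this.tendsto
  have hlim := hPlim.mul hblim
  have hPc : P 1 * (c * (starRingEnd ℂ) (P 1)) = c := by
    rw [mul_left_comm, mul_conj, normSq_eq_norm_sq, hP1]
    simp
  rw [hPc] at hlim
  have hsv : Tendsto (fun s : ℝ => ‖(s : ℂ) * v‖) (nhds 0) (nhds 0) := by
    have : ContinuousAt (fun s : ℝ => ‖(s : ℂ) * v‖) 0 := by fun_prop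
    simpa using this.tendsto
  obtain ⟨s, hs, hsδ, hw, hsε, hd⟩ := (eventually_mem_nhdsWithin.and
    (((eventually_lt_nhds hδ).filter_mono hle).and ((eventually_norm_one_sub_mul_lt_one hv).and
      (((hsv.eventually_lt_const hε).filter_mono hle).and
        ((hlim.eventually (ball_mem_nhds c hη)).filter_mono hle))))).exists
  have hs : 0 < s := hs
  refine ⟨1 - s * v, s, hw, hs, hsδ, by simpa using hsε, ?_⟩
  rw [discInvolution_one_sub_mul hs.ne']
  exact hd

lemma exists_seq_of_forall_exists {α : Type*} {R : ℕ → α → α → Prop}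
    (h : ∀ n x, ∃ y, R n x y) (a : α) :
    ∃ f : ℕ → α, f 0 = a ∧ ∀ n, R n (f n) (f (n + 1)) := by
  choose g hg using h
  exact ⟨fun n => Nat.rec a (fun n x => g n x) n, rfl, fun n => hg n _⟩

lemma exists_zeros_radii_approx (c : ℕ → ℂ) (hc : ∀ n, ‖c n‖ < 1) :
    ∃ (w : ℕ → ℂ) (s : ℕ → ℝ), (∀ n, ‖w n‖ < 1) ∧ (∀ n, 0 < s n ∧ s n < 1) ∧
      (∀ n, ‖1 - w n‖ ≤ (1 / 2) ^ n) ∧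
      (∀ n k, n < k → ‖1 - w k‖ ≤ (1 / 2) ^ k * s n) ∧
      ∀ n, dist (∏ k ∈ Finset.range (n + 1), discInvolution (w k) ((1 - s n : ℝ) : ℂ)) (c n)
        ≤ (1 / 2) ^ n := by
  let α := {x : (ℂ → ℂ) × ℂ × ℝ // ContinuousAt x.1 1 ∧ ‖x.1 1‖ = 1 ∧ 0 < x.2.2}
  let R : ℕ → α → α → Prop := fun n x y =>
    (∀ z, y.1.1 z = x.1.1 z * discInvolution y.1.2.1 z) ∧ ‖y.1.2.1‖ < 1 ∧
      y.1.2.2 < x.1.2.2 ∧ ‖1 - y.1.2.1‖ ≤ (1 / 2) ^ n * x.1.2.2 ∧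
      dist (y.1.1 ((1 - y.1.2.2 : ℝ) : ℂ)) (c n) ≤ (1 / 2) ^ n
  have hR : ∀ n x, ∃ y, R n x y := by
    rintro n ⟨⟨P, w₀, t⟩, hP, hP1, ht⟩
    obtain ⟨w, s, hw, hs, hst, h1w, hd⟩ := exists_discInvolution_approx hP hP1 (hc n) ht
      (ε := (1 / 2) ^ n * t) (η := (1 / 2) ^ n) (by positivity) (by positivity)
    refine ⟨⟨⟨fun z => P z * discInvolution w z, w, s⟩,
      hP.mul (continuousAt_discInvolution_one hw), ?_, hs⟩, fun z => rfl, hw, hst, h1w.le, hd.le⟩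
    simp only [norm_mul]
    rw [hP1, norm_discInvolution_one hw, one_mul]
  obtain ⟨f, hf0, hf⟩ := exists_seq_of_forall_exists hR
    ⟨⟨fun _ => 1, 0, 1⟩, continuousAt_const, norm_one, one_pos⟩
  have hanti : StrictAnti fun n => (f n).1.2.2 := strictAnti_nat_of_succ_lt fun n => (hf n).2.2.1
  have h0 : (f 0).1.2.2 = 1 := by rw [hf0]
  have hprod : ∀ n z, (f n).1.1 z = ∏ k ∈ Finset.range n, discInvolution (f (k + 1)).1.2.1 z := by
    intro n z
    induction n with
    | zero => rw [hf0]; simp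
    | succ n ih => rw [(hf n).1 z, ih, Finset.prod_range_succ]
  refine ⟨fun n => (f (n + 1)).1.2.1, fun n => (f (n + 1)).1.2.2, fun n => (hf n).2.1,
    fun n => ⟨(f (n + 1)).2.2.2, (hanti n.succ_pos).trans_eq h0⟩, fun n => ?_, fun n k hnk => ?_,
    fun n => ?_⟩
  · refine (hf n).2.2.2.1.trans (mul_le_of_le_one_right (by positivity) ?_)
    exact (hanti.antitone n.zero_le).trans_eq h0
  · refine (hf k).2.2.2.1.trans (mul_le_mul_of_nonneg_left ?_ (by positivity))
    exact hanti.antitone hnk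
  · rw [← hprod]
    exact (hf n).2.2.2.2

lemma dist_prod_discInvolution_succ_le {w : ℕ → ℂ} (hw : ∀ n, ‖w n‖ < 1) {z : ℂ} (hz : ‖z‖ < 1)
    (n : ℕ) :
    dist (∏ k ∈ Finset.range n, discInvolution (w k) z)
      (∏ k ∈ Finset.range (n + 1), discInvolution (w k) z) ≤ 2 * ‖1 - w n‖ / (1 - ‖z‖) := by
  rw [dist_comm, dist_eq_norm, Finset.prod_range_succ, ← mul_sub_one, norm_mul]
  refine (mul_le_of_le_one_left (norm_nonneg _) ?_).trans
    (norm_discInvolution_sub_one_le (hw n) hz)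
  rw [norm_prod]
  exact Finset.prod_le_one (fun _ _ => norm_nonneg _)
    fun k _ => norm_discInvolution_le_one (hw k) hz.le

lemma exists_seq_ball_frequently_dense :
    ∃ c : ℕ → ℂ, (∀ n, ‖c n‖ < 1) ∧
      ∀ x ∈ closedBall (0 : ℂ) 1, ∀ ε > 0, ∀ N, ∃ n ≥ N, dist x (c n) < ε := by
  have : Nonempty (ball (0 : ℂ) 1) := ⟨⟨0, by simp⟩⟩
  let d := TopologicalSpace.denseSeq (ball (0 : ℂ) 1)
  refine ⟨fun n => d n.unpair.1, fun n => mem_ball_zero_iff.mp (d n.unpair.1).2, ?_⟩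
  intro x hx ε hε N
  rw [← closure_ball (0 : ℂ) one_ne_zero] at hx
  obtain ⟨y, hy, hxy⟩ := Metric.mem_closure_iff.mp hx (ε / 2) (half_pos hε)
  obtain ⟨m, hm⟩ := (TopologicalSpace.denseRange_denseSeq (ball (0 : ℂ) 1)).exists_dist_lt
    ⟨y, hy⟩ (half_pos hε)
  refine ⟨Nat.pair m N, Nat.right_le_pair m N, ?_⟩
  have hm : dist y (d m) < ε / 2 := hm
  simp only [Nat.unpair_pair]
  linarith [dist_triangle x y (d m)]

/-- There is an infinite Blaschke product mapping the radius from `0` to `1` onto a dense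
subset of the closed unit disc. -/
theorem exists_blaschke_dense_radial_image :
    ∃ B : ℂ → ℂ, IsInfiniteBlaschke B ∧
      Metric.closedBall (0:ℂ) 1 ⊆
        closure {c : ℂ | ∃ r : ℝ, r ∈ Set.Ioo (0:ℝ) 1 ∧ B (r : ℂ) = c} := by
  obtain ⟨c, hc, hdense⟩ := exists_seq_ball_frequently_dense
  obtain ⟨w, s, hw, hs, hw1, hws, happrox⟩ := exists_zeros_radii_approx c hc
  let p : ℂ → ℕ → ℂ := fun z n => ∏ k ∈ Finset.range n, discInvolution (w k) z
  have hlim : ∀ z ∈ ball (0 : ℂ) 1, Tendsto (p z) atTop (nhds (limUnder atTop (p z))) := by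
    intro z hz
    have hz : ‖z‖ < 1 := by simpa using hz
    refine (cauchySeq_of_le_geometric_two (C := 4 / (1 - ‖z‖)) fun n => ?_).tendsto_limUnder
    refine (dist_prod_discInvolution_succ_le hw hz n).trans ?_
    have hz' : 0 < 1 - ‖z‖ := by linarith
    calc 2 * ‖1 - w n‖ / (1 - ‖z‖) ≤ 2 * (1 / 2) ^ n / (1 - ‖z‖) := by gcongr; exact hw1 n
      _ = 4 / (1 - ‖z‖) / 2 / 2 ^ n := by rw [one_div_pow]; field_simp; norm_num
  refine ⟨fun z => limUnder atTop (p z), ⟨fun _ => -1, w, by simp, hw, ?_, hlim⟩, ?_⟩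
  · refine Summable.of_nonneg_of_le (fun n => by linarith [hw n]) (fun n => ?_)
      summable_geometric_two
    have := norm_sub_norm_le 1 (w n)
    rw [norm_one] at this
    exact this.trans (hw1 n)
  · intro x hx
    rw [Metric.mem_closure_iff]
    intro ε hε
    obtain ⟨N, hN⟩ := exists_pow_lt_of_lt_one (show (0 : ℝ) < ε / 6 by positivity)
      (show (1 / 2 : ℝ) < 1 by norm_num)
    obtain ⟨n, hnN, hxn⟩ := hdense x hx (ε / 2) (half_pos hε) N
    have hn : (1 / 2 : ℝ) ^ n < ε / 6 :=
      (pow_le_pow_of_le_one (by norm_num) (by norm_num) hnN).trans_lt hN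
    obtain ⟨hs0, hs1⟩ := hs n
    have hznorm : ‖((1 - s n : ℝ) : ℂ)‖ = 1 - s n := by
      rw [norm_real, Real.norm_of_nonneg (by linarith)]
    refine ⟨_, ⟨1 - s n, ⟨by linarith, by linarith⟩, rfl⟩, ?_⟩
    set z : ℂ := ((1 - s n : ℝ) : ℂ) with hzdef
    have hz : ‖z‖ < 1 := by linarith
    have htail : dist (p z (n + 1)) (limUnder atTop (p z)) ≤ 2 * (1 / 2) ^ n := by
      have hstep : ∀ m, dist (p z (m + (n + 1))) (p z (m + 1 + (n + 1))) ≤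
          2 * (1 / 2) ^ n / 2 / 2 ^ m := by
        intro m
        rw [add_right_comm]
        refine (dist_prod_discInvolution_succ_le hw hz _).trans ?_
        rw [hznorm, sub_sub_cancel, div_le_iff₀ hs0]
        have := hws n (m + (n + 1)) (by omega)
        calc 2 * ‖1 - w (m + (n + 1))‖ ≤ 2 * ((1 / 2) ^ (m + (n + 1)) * s n) := by gcongr
          _ = 2 * (1 / 2) ^ n / 2 / 2 ^ m * s n := by
            rw [pow_add, pow_succ, one_div_pow, one_div_pow]; field_simp
      simpa only [zero_add] using dist_le_of_le_geometric_two_of_tendsto₀ hstep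
        ((tendsto_add_atTop_iff_nat (n + 1)).mpr (hlim z (by simpa using hz)))
    have h1 : dist (p z (n + 1)) (c n) ≤ (1 / 2) ^ n := happrox n
    have h3 := dist_triangle x (c n) (limUnder atTop (p z))
    have h4 := dist_triangle_left (c n) (limUnder atTop (p z)) (p z (n + 1))
    linarith
end
end

section
/- Let K be a compact subset of the unit circle of arclength measure 0. Then the set of zero-free functions f in the closed unit ball of H^∞ such that for every continuous φ : K → ℂ with sup_K |φ| ≤ 1 there exists a sequence (r_n) in (0,1) converging to 1 with sup_{z∈K} |f(r_n z) − φ(z)| → 0, is a dense G_δ subset of the space 𝒮 of zero-free functions in the closed unit ball of H^∞, endowed with the topology of locally uniform convergence. -/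
open Complex Metric MeasureTheory Filter Set

noncomputable section

/-- The family of compact subsets of the open unit disc. -/
def discCompacts : Set (Set ℂ) := {L | L ⊆ Metric.ball (0:ℂ) 1 ∧ IsCompact L}

/-- The closed unit ball `𝓑` of `H^∞`, as a subset of the space of functions `ℂ → ℂ`
equipped with the topology of uniform convergence on compact subsets of the open unit disc
(locally uniform convergence on `𝔻`). -/
def HinftyBall : Set (UniformOnFun ℂ ℂ discCompacts) :=
  {f | DifferentiableOn ℂ (UniformOnFun.toFun discCompacts f) (Metric.ball (0:ℂ) 1) ∧
       ∀ z ∈ Metric.ball (0:ℂ) 1, ‖UniformOnFun.toFun discCompacts f z‖ ≤ 1}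

/-- The space `𝒮` of zero-free functions in the closed unit ball of `H^∞`, with the topology of
locally uniform convergence. -/
def ZeroFreeBall : Set (UniformOnFun ℂ ℂ discCompacts) :=
  {f | f ∈ HinftyBall ∧ ∀ z ∈ Metric.ball (0:ℂ) 1, UniformOnFun.toFun discCompacts f z ≠ 0}

/-- The class of radially universal functions for `K` inside `𝒮`. -/
def UnivClassS (K : Set ℂ) : Set ↥ZeroFreeBall :=
  {f | ∀ φ : ℂ → ℂ, ContinuousOn φ K → (∀ z ∈ K, ‖φ z‖ ≤ 1) →
    ∃ r : ℕ → ℝ, (∀ n, r n ∈ Set.Ioo (0:ℝ) 1) ∧ Tendsto r atTop (nhds 1) ∧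
      Tendsto (fun n => ⨆ z ∈ K,
          ‖UniformOnFun.toFun discCompacts f.1 ((r n : ℂ) * z) - φ z‖)
        atTop (nhds 0)}

theorem exists_finite_ball_cover {K : Set ℂ} (hKc : IsCompact K)
    (hKs : K ⊆ sphere (0:ℂ) 1) (hK0 : arclength K = 0) {ε : ℝ} (hε : 0 < ε) :
    ∃ (ι : Type) (u : Finset ι) (c : ι → ℂ) (l : ι → ℝ),
      (∀ i, c i ∈ K) ∧ (∀ i, 0 < l i) ∧ (∀ z ∈ K, ∃ i ∈ u, dist z (c i) < l i) ∧
        ∑ i ∈ u, l i ≤ ε := by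
  set s : Set ℝ := circleMap 0 1 ⁻¹' K ∩ Ioc 0 (2 * Real.pi)
  have hvol : volume s = 0 := by
    have hm : MeasurableSet (circleMap 0 1 ⁻¹' K) :=
      (continuous_circleMap 0 1).measurable hKc.measurableSet
    rw [arclength, Measure.map_apply (continuous_circleMap 0 1).measurable hKc.measurableSet,
      Measure.restrict_apply hm] at hK0
    exact hK0
  obtain ⟨t, r, -, hts, hr, hcov, hsum⟩ := Besicovitch.exists_closedBall_covering_tsum_measure_le
    (volume : Measure ℝ) (ε := ENNReal.ofReal ε) (by simpa using hε) (fun _ => Ioi 0) s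
    (fun x _ δ hδ => ⟨δ / 2, by simp [hδ], by simp [hδ]⟩)
  have hK : K ⊆ ⋃ i : t, ball (circleMap 0 1 i) (2 * r i) := by
    intro z hz
    obtain ⟨θ, hθ, rfl⟩ : z ∈ circleMap 0 1 '' Ioc 0 (2 * Real.pi) := by
      have := hKs hz
      rwa [image_circleMap_Ioc, abs_one]
    obtain ⟨x, hx, hxr⟩ := mem_iUnion₂.1 (hcov ⟨hz, hθ⟩)
    refine mem_iUnion.2 ⟨⟨x, hx⟩, ?_⟩
    have h1 := (lipschitzWith_circleMap 0 1).dist_le_mul θ x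
    have h2 : 0 < r x := hr x hx
    rw [mem_closedBall] at hxr
    simp only [mem_ball]
    simp at h1
    linarith
  obtain ⟨u, hu⟩ := hKc.elim_finite_subcover _ (fun _ => isOpen_ball) hK
  refine ⟨t, u, fun i => circleMap 0 1 i, fun i => 2 * r i, fun i => (hts i.2).1,
    fun i => mul_pos two_pos (hr i i.2), fun z hz => by simpa using hu hz, ?_⟩
  have h1 : ∑ i ∈ u, volume (closedBall (i : ℝ) (r i)) ≤ ENNReal.ofReal ε := by
    calc _ ≤ ∑' i : t, volume (closedBall (i : ℝ) (r i)) := ENNReal.sum_le_tsum u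
      _ ≤ _ := by simpa [hvol] using hsum
  simp only [Real.volume_closedBall] at h1
  rw [← ENNReal.ofReal_sum_of_nonneg (fun (i : t) _ => (mul_pos two_pos (hr i i.2)).le)] at h1
  exact (ENNReal.ofReal_le_ofReal_iff hε.le).1 h1

theorem exists_radius_dist_ne {K : Set ℂ} (hKc : IsCompact K)
    (hKs : K ⊆ sphere (0:ℂ) 1) (hK0 : arclength K = 0) (x : ℂ) {ρ : ℝ} (hρ : 0 < ρ) :
    ∃ ρ' ∈ Ioo 0 ρ, ∀ z ∈ K, dist z x ≠ ρ' := by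
  by_contra! hcon
  obtain ⟨ι, u, c, l, -, hl, hcov, hsum⟩ :=
    exists_finite_ball_cover hKc hKs hK0 (ε := ρ / 4) (by positivity)
  have hsub : Ioo 0 ρ ⊆ ⋃ i ∈ u, ball (dist (c i) x) (l i) := by
    intro ρ' hρ'
    obtain ⟨z, hz, rfl⟩ := hcon ρ' hρ'
    obtain ⟨i, hi, hd⟩ := hcov z hz
    refine mem_iUnion₂.2 ⟨i, hi, ?_⟩
    exact (dist_dist_dist_le_left z (c i) x).trans_lt hd
  have h1 : volume (Ioo 0 ρ) ≤ ∑ i ∈ u, volume (ball (dist (c i) x) (l i)) :=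
    (measure_mono hsub).trans (measure_biUnion_finset_le _ _)
  simp only [Real.volume_ball, Real.volume_Ioo] at h1
  rw [← ENNReal.ofReal_sum_of_nonneg (fun i _ => (mul_pos two_pos (hl i)).le),
    ENNReal.ofReal_le_ofReal_iff (Finset.sum_nonneg fun i _ => (mul_pos two_pos (hl i)).le),
    ← Finset.mul_sum] at h1
  linarith

/-- A holomorphic function with positive real part that is large on a null compact subset `E` of
the circle and small on a compact set disjoint from `E`. -/
theorem exists_re_pos_large_small {E L : Set ℂ} (hEc : IsCompact E)
    (hEs : E ⊆ sphere (0:ℂ) 1) (hE0 : arclength E = 0) (hL : IsCompact L) (hEL : Disjoint E L)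
    {A δ : ℝ} (hA : 0 < A) (hδ : 0 < δ) :
    ∃ P : ℂ → ℂ, DifferentiableOn ℂ P (closedBall 0 1) ∧ (∀ z ∈ closedBall (0:ℂ) 1, 0 < (P z).re) ∧
      (∀ z ∈ E, A ≤ ‖P z‖) ∧ ∀ z ∈ L ∩ closedBall (0:ℂ) 1, ‖P z‖ ≤ δ := by
  obtain ⟨d, hd, hdist⟩ : ∃ d > 0, ∀ x ∈ E, ∀ y ∈ L, d ≤ dist x y := by
    obtain ⟨d, hd, h⟩ := hEL.exists_thickenings hEc hL.isClosed
    refine ⟨d, hd, fun x hx y hy => ?_⟩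
    by_contra! hlt
    exact Set.disjoint_left.1 h (self_subset_thickening hd _ hx)
      (mem_thickening_iff.2 ⟨y, hy, hlt⟩)
  obtain ⟨ι, u, c, l, hcE, hl, hcov, hsum⟩ :=
    exists_finite_ball_cover hEc hEs hE0 (ε := d * δ / 2 / (4 * A)) (by positivity)
  have hc1 : ∀ i, ‖c i‖ = 1 := fun i => by simpa using hEs (hcE i)
  have hcc : ∀ i z, ‖1 - (starRingEnd ℂ) (c i) * z‖ = dist (c i) z := fun i z => by
    have h : 1 - (starRingEnd ℂ) (c i) * z = (starRingEnd ℂ) (c i) * (c i - z) := by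
      rw [mul_sub, conj_mul', hc1]; simp
    rw [h, norm_mul, RCLike.norm_conj, hc1, one_mul, dist_eq_norm]
  have hre : ∀ i, ∀ z ∈ closedBall (0:ℂ) 1, 0 ≤ (1 - (starRingEnd ℂ) (c i) * z).re := by
    intro i z hz
    have h1 : ((starRingEnd ℂ) (c i) * z).re ≤ ‖(starRingEnd ℂ) (c i) * z‖ := re_le_norm _
    rw [norm_mul, RCLike.norm_conj, hc1, one_mul] at h1
    have h2 : ‖z‖ ≤ 1 := by simpa using hz
    simp only [sub_re, one_re]
    linarith
  set D : ι → ℂ → ℂ := fun i z => (l i : ℂ) + (1 - (starRingEnd ℂ) (c i) * z) with hD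
  have hDre : ∀ i, ∀ z ∈ closedBall (0:ℂ) 1, l i ≤ (D i z).re := fun i z hz => by
    have := hre i z hz
    simp only [hD, add_re, ofReal_re]
    linarith
  have hD0 : ∀ i, ∀ z ∈ closedBall (0:ℂ) 1, D i z ≠ 0 := fun i z hz h => by
    have := hDre i z hz
    rw [h, zero_re] at this
    linarith [hl i]
  have hterm : ∀ i, ∀ z ∈ closedBall (0:ℂ) 1, 0 ≤ ((l i : ℂ) / D i z).re := fun i z hz => by
    rw [div_re]
    have h1 := hDre i z hz
    have h2 := hl i
    have : 0 ≤ (D i z).re := by linarith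
    simp only [ofReal_re, ofReal_im, zero_mul, zero_div, add_zero]
    exact div_nonneg (mul_nonneg h2.le this) (normSq_nonneg _)
  set P : ℂ → ℂ := fun z => (δ / 2 : ℝ) + ((4 * A : ℝ) : ℂ) * ∑ i ∈ u, (l i : ℂ) / D i z with hP
  have hPre : ∀ z, (P z).re = δ / 2 + 4 * A * ∑ i ∈ u, ((l i : ℂ) / D i z).re := fun z => by
    simp only [hP, add_re, ofReal_re, re_ofReal_mul, re_sum]
  refine ⟨P, ?_, ?_, ?_, ?_⟩
  · refine (differentiableOn_const _).add ((differentiableOn_const _).mul ?_)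
    refine DifferentiableOn.fun_sum fun i _ => ?_
    refine (differentiableOn_const _).div ?_ (hD0 i)
    exact Differentiable.differentiableOn (by fun_prop)
  · intro z hz
    rw [hPre]
    have := Finset.sum_nonneg fun i (_ : i ∈ u) => hterm i z hz
    positivity
  · intro z hz
    have hz1 : z ∈ closedBall (0:ℂ) 1 := sphere_subset_closedBall (hEs hz)
    refine le_trans ?_ (re_le_norm _)
    rw [hPre]
    obtain ⟨i, hi, hzi⟩ := hcov z hz
    have h1 := Finset.single_le_sum (f := fun i => ((l i : ℂ) / D i z).re)
      (fun i _ => hterm i z hz1) hi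
    have h2 : 1 / 4 ≤ ((l i : ℂ) / D i z).re := by
      have hn : ‖D i z‖ ≤ 2 * l i := by
        refine (norm_add_le _ _).trans ?_
        rw [hcc, norm_real, Real.norm_of_nonneg (hl i).le, dist_comm]
        linarith
      rw [div_re]
      simp only [ofReal_re, ofReal_im, zero_mul, zero_div, add_zero]
      rw [normSq_eq_norm_sq, div_le_div_iff₀ (by norm_num) (by have := hD0 i z hz1; positivity)]
      have := hDre i z hz1
      have := hl i
      nlinarith [norm_nonneg (D i z)]
    nlinarith
  · rintro z ⟨hzL, hz⟩
    have hi : ∀ i ∈ u, ‖(l i : ℂ) / D i z‖ ≤ l i / d := fun i _ => by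
      rw [norm_div, norm_real, Real.norm_of_nonneg (hl i).le]
      have h1 : d ≤ ‖D i z‖ := by
        refine (hdist _ (hcE i) z hzL).trans ?_
        rw [← hcc, Complex.norm_def, Complex.norm_def]
        refine Real.sqrt_le_sqrt ?_
        have := hre i z hz
        have := hl i
        simp only [hD, normSq_apply, add_re, add_im, ofReal_re, ofReal_im, zero_add]
        nlinarith
      have := (hl i).le
      gcongr
    have h2 : ‖∑ i ∈ u, (l i : ℂ) / D i z‖ ≤ δ / 2 / (4 * A) := by
      refine (norm_sum_le_of_le _ hi).trans ?_
      rw [← Finset.sum_div, div_le_iff₀ hd]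
      refine hsum.trans (le_of_eq (by ring))
    calc ‖P z‖ ≤ δ / 2 + 4 * A * ‖∑ i ∈ u, (l i : ℂ) / D i z‖ := by
          refine (norm_add_le _ _).trans ?_
          rw [norm_mul, norm_real, norm_real, Real.norm_of_nonneg (by positivity),
            Real.norm_of_nonneg (by positivity)]
      _ ≤ δ / 2 + 4 * A * (δ / 2 / (4 * A)) := by gcongr
      _ = δ := by field_simp; norm_num

/-- A holomorphic function with values in a thin neighbourhood of `[0, 1]`, close to `1` on a null
compact subset `E` of the circle and close to `0` on a compact set disjoint from `E`. -/
theorem exists_thin_peak {E L : Set ℂ} (hEc : IsCompact E)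
    (hEs : E ⊆ sphere (0:ℂ) 1) (hE0 : arclength E = 0) (hL : IsCompact L) (hEL : Disjoint E L)
    {δ : ℝ} (hδ : 0 < δ) :
    ∃ q : ℂ → ℂ, DifferentiableOn ℂ q (closedBall 0 1) ∧
      (∀ z ∈ closedBall (0:ℂ) 1, 0 ≤ (q z).re ∧ (q z).re ≤ 1 ∧ |(q z).im| ≤ δ) ∧
      (∀ z ∈ E, ‖q z - 1‖ ≤ δ) ∧ ∀ z ∈ L ∩ closedBall (0:ℂ) 1, ‖q z‖ ≤ δ := by
  set α : ℝ := min δ 1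
  have hα0 : 0 < α := lt_min hδ one_pos
  obtain ⟨P, hPd, hPre, hPE, hPL⟩ := exists_re_pos_large_small hEc hEs hE0 hL hEL
    (A := Real.exp (-Real.log δ / α)) (δ := Real.exp (Real.log δ / α)) (Real.exp_pos _)
    (Real.exp_pos _)
  set w : ℂ → ℂ := fun z => exp (α * log (P z)) with hw
  have hwn : ∀ z, ‖w z‖ = Real.exp (α * Real.log ‖P z‖) := fun z => by
    rw [hw, norm_exp, re_ofReal_mul, log_re]
  have hwarg : ∀ z ∈ closedBall (0:ℂ) 1, |(P z).arg| ≤ Real.pi / 2 := fun z hz =>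
    abs_arg_le_pi_div_two_iff.2 (hPre z hz).le
  have hwre : ∀ z ∈ closedBall (0:ℂ) 1, 0 ≤ (w z).re := fun z hz => by
    rw [hw, exp_re, im_ofReal_mul, log_im]
    refine mul_nonneg (Real.exp_pos _).le (Real.cos_nonneg_of_mem_Icc (abs_le.1 ?_))
    rw [abs_mul, abs_of_pos hα0]
    have : α ≤ 1 := min_le_right _ _
    nlinarith [hwarg z hz, abs_nonneg (P z).arg]
  have hwim : ∀ z ∈ closedBall (0:ℂ) 1, |(w z).im| ≤ ‖w z‖ * (2 * δ) := fun z hz => by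
    have h0 : (w z).im = ‖w z‖ * Real.sin (α * (P z).arg) := by
      rw [hwn, hw, exp_im, im_ofReal_mul, log_im, re_ofReal_mul, log_re]
    rw [h0, abs_mul, abs_norm]
    gcongr
    refine (Real.abs_sin_le_abs).trans ?_
    rw [abs_mul, abs_of_pos hα0]
    have : α ≤ δ := min_le_left _ _
    have := hwarg z hz
    have := Real.pi_le_four
    nlinarith [abs_nonneg (P z).arg]
  have hsq : ∀ z ∈ closedBall (0:ℂ) 1, 1 + ‖w z‖ ^ 2 ≤ normSq (1 + w z) := fun z hz => by
    rw [← normSq_eq_norm_sq, normSq_apply, normSq_apply]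
    simp only [add_re, one_re, add_im, one_im]
    nlinarith [hwre z hz]
  have hpos : ∀ z ∈ closedBall (0:ℂ) 1, 0 < normSq (1 + w z) := fun z hz =>
    lt_of_lt_of_le (by positivity) (hsq z hz)
  have hne : ∀ z ∈ closedBall (0:ℂ) 1, 1 + w z ≠ 0 := fun z hz => normSq_pos.1 (hpos z hz)
  have hn1 : ∀ z ∈ closedBall (0:ℂ) 1, 1 ≤ ‖1 + w z‖ ∧ ‖w z‖ ≤ ‖1 + w z‖ := fun z hz => by
    have := hsq z hz
    rw [normSq_eq_norm_sq] at this
    constructor <;> nlinarith [norm_nonneg (w z), norm_nonneg (1 + w z)]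
  refine ⟨fun z => w z / (1 + w z), ?_, ?_, ?_, ?_⟩
  · have hwd : DifferentiableOn ℂ w (closedBall 0 1) :=
      ((differentiableOn_const _).mul (hPd.clog fun z hz => Or.inl (hPre z hz))).cexp
    exact hwd.div ((differentiableOn_const _).add hwd) hne
  · intro z hz
    have h1 := hwre z hz
    have h2 := hpos z hz
    have h3 : (w z / (1 + w z)).re = ((w z).re + ‖w z‖ ^ 2) / normSq (1 + w z) := by
      rw [div_re, ← normSq_eq_norm_sq, normSq_apply (w z)]
      simp only [add_re, one_re, add_im, one_im]
      ring
    have h4 : (w z / (1 + w z)).im = (w z).im / normSq (1 + w z) := by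
      rw [div_im]
      simp only [add_re, one_re, add_im, one_im]
      ring
    refine ⟨by rw [h3]; positivity, ?_, ?_⟩
    · rw [h3, div_le_one h2, ← normSq_eq_norm_sq, normSq_apply, normSq_apply]
      simp only [add_re, one_re, add_im, one_im]
      nlinarith
    · rw [h4, abs_div, abs_of_pos h2, div_le_iff₀ h2]
      have := hwim z hz
      have := hsq z hz
      nlinarith [sq_nonneg (‖w z‖ - 1)]
  · intro z hzE
    have hz : z ∈ closedBall (0:ℂ) 1 := sphere_subset_closedBall (hEs hzE)
    have h1 : w z / (1 + w z) - 1 = -(1 / (1 + w z)) := by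
      field_simp [hne z hz]; ring
    have h2 : δ⁻¹ ≤ ‖w z‖ := by
      rw [hwn, ← Real.exp_log (inv_pos.2 hδ), Real.exp_le_exp, Real.log_inv]
      have := Real.log_le_log (Real.exp_pos _) (hPE z hzE)
      rw [Real.log_exp, div_le_iff₀ hα0] at this
      linarith
    rw [h1, norm_neg, norm_div, norm_one, one_div]
    exact inv_le_of_inv_le₀ hδ (h2.trans (hn1 z hz).2)
  · rintro z ⟨hzL, hz⟩
    have hP0 : 0 < ‖P z‖ := norm_pos_iff.2 fun h => by
      have := hPre z hz
      rw [h] at this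
      simp at this
    have h2 : ‖w z‖ ≤ δ := by
      rw [hwn, ← Real.exp_log hδ, Real.exp_le_exp]
      have := Real.log_le_log hP0 (hPL z ⟨hzL, hz⟩)
      rw [Real.log_exp, le_div_iff₀ hα0] at this
      linarith
    rw [norm_div]
    exact (div_le_self (norm_nonneg _) (hn1 z hz).1).trans h2

theorem exists_modify_near {E L : Set ℂ} (hEc : IsCompact E)
    (hEs : E ⊆ sphere (0:ℂ) 1) (hE0 : arclength E = 0) (hL : IsCompact L) (hEL : Disjoint E L)
    {h : ℂ → ℂ} (hd : DifferentiableOn ℂ h (closedBall 0 1))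
    (hre : ∀ z ∈ closedBall (0:ℂ) 1, (h z).re < 0) {c : ℂ} (hc : c.re < 0)
    {η : ℝ} (hη : 0 < η) :
    ∃ g : ℂ → ℂ, DifferentiableOn ℂ g (closedBall 0 1) ∧
      (∀ z ∈ closedBall (0:ℂ) 1, (g z).re < 0) ∧
      (∀ z ∈ E, ‖g z - c‖ ≤ η) ∧ ∀ z ∈ L ∩ closedBall (0:ℂ) 1, ‖g z - h z‖ ≤ η := by
  have hcomp : IsCompact (closedBall (0:ℂ) 1) := isCompact_closedBall 0 1
  obtain ⟨M, hM⟩ := hcomp.exists_bound_of_continuousOn (continuousOn_const.sub hd.continuousOn)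
    (f := fun z => c - h z)
  obtain ⟨z₀, hz₀, hmax⟩ := hcomp.exists_isMaxOn ⟨0, by simp⟩
    (continuous_re.comp_continuousOn hd.continuousOn)
  set m : ℝ := min (-c.re) (-(h z₀).re)
  have hm0 : 0 < m := lt_min (by linarith) (by linarith [hre z₀ hz₀])
  have hmh : ∀ z ∈ closedBall (0:ℂ) 1, (h z).re ≤ -m := fun z hz => by
    have h1 : (h z).re ≤ (h z₀).re := hmax hz
    linarith [min_le_right (-c.re) (-(h z₀).re)]
  have hmc : c.re ≤ -m := by linarith [min_le_left (-c.re) (-(h z₀).re)]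
  have hM0 : 0 ≤ M := (norm_nonneg _).trans (hM 0 (by simp))
  set δ : ℝ := min η (m / 2) / (M + 1) with hδ
  have hδ0 : 0 < δ := by positivity
  have hδη : δ * M ≤ min η (m / 2) := by
    rw [hδ, div_mul_eq_mul_div, div_le_iff₀ (by positivity)]
    have : 0 < min η (m / 2) := by positivity
    nlinarith
  have hδη1 := hδη.trans (min_le_left _ _)
  have hδη2 := hδη.trans (min_le_right _ _)
  obtain ⟨q, hqd, hq, hqE, hqL⟩ := exists_thin_peak hEc hEs hE0 hL hEL hδ0
  refine ⟨fun z => h z + q z * (c - h z), hd.add (hqd.mul ((differentiableOn_const _).sub hd)),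
    ?_, ?_, ?_⟩
  · intro z hz
    obtain ⟨h0, h1, h2⟩ := hq z hz
    have h3 : |(q z).im * (c - h z).im| ≤ δ * M := by
      rw [abs_mul]
      exact mul_le_mul h2 ((abs_im_le_norm _).trans (hM z hz)) (abs_nonneg _) hδ0.le
    have h4 := neg_le_of_abs_le h3
    simp only [add_re, mul_re, sub_re]
    have h5 := hmh z hz
    nlinarith
  · intro z hzE
    have hz : z ∈ closedBall (0:ℂ) 1 := sphere_subset_closedBall (hEs hzE)
    have : h z + q z * (c - h z) - c = (q z - 1) * (c - h z) := by ring
    rw [this, norm_mul]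
    exact (mul_le_mul (hqE z hzE) (hM z hz) (norm_nonneg _) hδ0.le).trans hδη1
  · intro z hz
    rw [add_sub_cancel_left, norm_mul]
    exact (mul_le_mul (hqL z hz) (hM z hz.2) (norm_nonneg _) hδ0.le).trans hδη1

theorem norm_exp_sub_exp_le {a b : ℂ} (ha : a.re ≤ 0) (hb : b.re ≤ 0) :
    ‖exp a - exp b‖ ≤ ‖a - b‖ := by
  have := (convex_halfSpace_re_le 0).norm_image_sub_le_of_norm_deriv_le (f := exp) (C := 1)
    (fun x _ => differentiableAt_exp)
    (fun x hx => by simpa [norm_exp] using hx) (x := b) (y := a) hb ha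
  simpa using this

theorem exists_re_neg_norm_exp_sub_lt {w : ℂ} (hw : ‖w‖ ≤ 1) {ε : ℝ} (hε : 0 < ε) :
    ∃ c : ℂ, c.re < 0 ∧ ‖exp c - w‖ < ε := by
  obtain ⟨v, hv0, hv1, hv⟩ : ∃ v : ℂ, v ≠ 0 ∧ ‖v‖ < 1 ∧ ‖v - w‖ < ε := by
    set t : ℝ := min (ε / 2) (1 / 2)
    have ht0 : 0 < t := by positivity
    have ht1 : t ≤ 1 / 2 := min_le_right _ _
    have ht2 : t ≤ ε / 2 := min_le_left _ _
    rcases eq_or_ne w 0 with rfl | hne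
    · refine ⟨t, by exact_mod_cast ht0.ne', ?_, ?_⟩
      · rw [norm_real, Real.norm_of_nonneg ht0.le]; linarith
      · rw [sub_zero, norm_real, Real.norm_of_nonneg ht0.le]; linarith
    · have hn := norm_pos_iff.2 hne
      refine ⟨(1 - t : ℝ) * w, mul_ne_zero (by exact_mod_cast (by linarith : 1 - t ≠ 0)) hne, ?_, ?_⟩
      · rw [norm_mul, norm_real, Real.norm_of_nonneg (by linarith)]
        nlinarith
      · have : ((1 - t : ℝ) : ℂ) * w - w = ((-t : ℝ) : ℂ) * w := by push_cast; ring
        rw [this, norm_mul, norm_real, norm_neg, Real.norm_of_nonneg ht0.le]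
        nlinarith
  refine ⟨log v, ?_, by rwa [exp_log hv0]⟩
  rw [log_re]
  exact Real.log_neg (norm_pos_iff.2 hv0) hv1

theorem exists_holomorphic_exp_approx {K : Set ℂ} (hKc : IsCompact K)
    (hKs : K ⊆ sphere (0:ℂ) 1) (hK0 : arclength K = 0) {h : ℂ → ℂ}
    (hd : DifferentiableOn ℂ h (closedBall 0 1))
    (hre : ∀ z ∈ closedBall (0:ℂ) 1, (h z).re < 0) {L : Set ℂ} (hL : IsCompact L)
    (hLb : L ⊆ ball (0:ℂ) 1) {φ : ℂ → ℂ} (hφ : ContinuousOn φ K) (hφ1 : ∀ z ∈ K, ‖φ z‖ ≤ 1)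
    {ε : ℝ} (hε : 0 < ε) :
    ∃ g : ℂ → ℂ, DifferentiableOn ℂ g (closedBall 0 1) ∧
      (∀ z ∈ closedBall (0:ℂ) 1, (g z).re < 0) ∧
      (∀ z ∈ L, ‖g z - h z‖ < ε) ∧ ∀ z ∈ K, ‖exp (g z) - φ z‖ < ε := by
  have hpiece : ∀ x ∈ K, ∃ (c : ℂ) (ρ : ℝ), c.re < 0 ∧ 0 < ρ ∧ (∀ z ∈ K, dist z x ≠ ρ) ∧
      ∀ z ∈ K, dist z x < ρ → ‖exp c - φ z‖ ≤ ε / 2 := by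
    intro x hx
    obtain ⟨c, hc, hcx⟩ := exists_re_neg_norm_exp_sub_lt (hφ1 x hx) (ε := ε / 4) (by positivity)
    obtain ⟨δ, hδ, hδφ⟩ := Metric.continuousOn_iff.1 hφ x hx (ε / 4) (by positivity)
    obtain ⟨ρ, hρ, hρK⟩ := exists_radius_dist_ne hKc hKs hK0 x hδ
    refine ⟨c, ρ, hc, hρ.1, hρK, fun z hz hzx => ?_⟩
    have h1 := hδφ z hz (hzx.trans hρ.2)
    rw [dist_comm, dist_eq_norm] at h1
    calc ‖exp c - φ z‖ ≤ ‖exp c - φ x‖ + ‖φ x - φ z‖ := norm_sub_le_norm_sub_add_norm_sub _ _ _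
      _ ≤ ε / 2 := by linarith
  choose! c ρ hc hρ hρK hcφ using hpiece
  obtain ⟨t, htK, htcov⟩ := hKc.elim_nhds_subcover (fun x => ball x (ρ x))
    (fun x hx => ball_mem_nhds x (hρ x hx))
  have key : ∀ s : Finset ℂ, (∀ x ∈ s, x ∈ K) → ∀ η > 0, ∃ g : ℂ → ℂ,
      DifferentiableOn ℂ g (closedBall 0 1) ∧ (∀ z ∈ closedBall (0:ℂ) 1, (g z).re < 0) ∧
      (∀ z ∈ L, ‖g z - h z‖ ≤ η) ∧
      ∀ x ∈ s, ∀ z ∈ K, dist z x < ρ x → ‖exp (g z) - φ z‖ ≤ ε / 2 + η := by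
    intro s
    induction s using Finset.induction_on with
    | empty => exact fun _ η hη => ⟨h, hd, hre, fun z _ => by simpa using hη.le, by simp⟩
    | insert a s _ ih =>
      intro hs η hη
      obtain ⟨g, hgd, hgre, hgL, hgs⟩ :=
        ih (fun x hx => hs x (Finset.mem_insert_of_mem hx)) (η / 2) (by positivity)
      have haK : a ∈ K := hs a (Finset.mem_insert_self a s)
      have hE : K ∩ closedBall a (ρ a) ⊆ K := inter_subset_left
      have hdisj : Disjoint (K ∩ closedBall a (ρ a)) (L ∪ K \ ball a (ρ a)) := by
        rw [Set.disjoint_left]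
        rintro z ⟨hzK, hza⟩ (hzL | ⟨-, hzb⟩)
        · exact (mem_sphere.1 (hKs hzK)).not_lt (mem_ball.1 (hLb hzL))
        · exact hρK a haK z hzK (le_antisymm (mem_closedBall.1 hza) (not_lt.1 hzb))
      obtain ⟨g', hgd', hgre', hgE', hgL'⟩ := exists_modify_near
        (hKc.inter_right isClosed_closedBall) (hE.trans hKs)
        (measure_mono_null hE hK0) (hL.union (hKc.diff isOpen_ball)) hdisj hgd hgre (hc a haK)
        (η := η / 2) (by positivity)
      have hKcl : ∀ z ∈ K, z ∈ closedBall (0:ℂ) 1 := fun z hz => sphere_subset_closedBall (hKs hz)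
      refine ⟨g', hgd', hgre', fun z hz => ?_, fun x hx z hz hzx => ?_⟩
      · have h1 := hgL' z ⟨Or.inl hz, ball_subset_closedBall (hLb hz)⟩
        have h2 := hgL z hz
        calc ‖g' z - h z‖ ≤ ‖g' z - g z‖ + ‖g z - h z‖ := norm_sub_le_norm_sub_add_norm_sub _ _ _
          _ ≤ η := by linarith
      · have hg'z := (hgre' z (hKcl z hz)).le
        by_cases hza : dist z a < ρ a
        · have h1 := hgE' z ⟨hz, hza.le⟩
          have h2 := hcφ a haK z hz hza
          have h3 := norm_exp_sub_exp_le hg'z (hc a haK).le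
          calc ‖exp (g' z) - φ z‖ ≤ ‖exp (g' z) - exp (c a)‖ + ‖exp (c a) - φ z‖ :=
                norm_sub_le_norm_sub_add_norm_sub _ _ _
            _ ≤ ε / 2 + η := by linarith
        · have hxs : x ∈ s := by
            rcases Finset.mem_insert.1 hx with rfl | hx
            · exact absurd hzx hza
            · exact hx
          have h1 := hgL' z ⟨Or.inr ⟨hz, hza⟩, hKcl z hz⟩
          have h2 := hgs x hxs z hz hzx
          have h3 := norm_exp_sub_exp_le hg'z (hgre z (hKcl z hz)).le
          calc ‖exp (g' z) - φ z‖ ≤ ‖exp (g' z) - exp (g z)‖ + ‖exp (g z) - φ z‖ :=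
                norm_sub_le_norm_sub_add_norm_sub _ _ _
            _ ≤ ε / 2 + η := by linarith
  obtain ⟨g, hgd, hgre, hgL, hgt⟩ := key t htK (ε / 4) (by positivity)
  refine ⟨g, hgd, hgre, fun z hz => (hgL z hz).trans_lt (by linarith), fun z hz => ?_⟩
  obtain ⟨x, hx, hzx⟩ := mem_iUnion₂.1 (htcov hz)
  exact (hgt x hx z hz hzx).trans_lt (by linarith)

theorem exists_radius_near_one {δ : ℝ} (hδ : 0 < δ) : ∃ r ∈ Ioo (0:ℝ) 1, 1 - δ < r := by
  obtain ⟨r, h1, h2⟩ := exists_between (max_lt zero_lt_one (by linarith : 1 - δ < 1))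
  exact ⟨r, ⟨(le_max_left _ _).trans_lt h1, h2⟩, (le_max_right _ _).trans_lt h1⟩

theorem norm_ofReal_mul_sub_le {r : ℝ} (hr : r ≤ 1) {z : ℂ} (hz : ‖z‖ ≤ 1) :
    ‖(r : ℂ) * z - z‖ ≤ 1 - r := by
  have : (r : ℂ) * z - z = ((-(1 - r) : ℝ) : ℂ) * z := by push_cast; ring
  rw [this, norm_mul, norm_real, norm_neg, Real.norm_of_nonneg (by linarith)]
  nlinarith

theorem exists_radial_exp_approx {K : Set ℂ} (hKc : IsCompact K)
    (hKs : K ⊆ sphere (0:ℂ) 1) (hK0 : arclength K = 0) {h : ℂ → ℂ}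
    (hd : DifferentiableOn ℂ h (ball 0 1)) (hre : ∀ z ∈ ball (0:ℂ) 1, (h z).re ≤ 0)
    {ρ : ℝ} (hρ : ρ < 1) {φ : ℂ → ℂ} (hφ : ContinuousOn φ K) (hφ1 : ∀ z ∈ K, ‖φ z‖ ≤ 1)
    {ε : ℝ} (hε : 0 < ε) :
    ∃ g : ℂ → ℂ, DifferentiableOn ℂ g (ball 0 1) ∧ (∀ z ∈ ball (0:ℂ) 1, (g z).re ≤ 0) ∧
      (∀ z ∈ closedBall (0:ℂ) ρ, ‖g z - h z‖ < ε) ∧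
      ∀ δ > 0, ∃ r ∈ Ioo (0:ℝ) 1, 1 - δ < r ∧ ∀ z ∈ K, ‖exp (g (r * z)) - φ z‖ < ε := by
  have hcl : closedBall (0:ℂ) ρ ⊆ ball 0 1 := closedBall_subset_ball hρ
  obtain ⟨δ, hδ, hδh⟩ := Metric.uniformContinuousOn_iff.1
    ((isCompact_closedBall (0:ℂ) ρ).uniformContinuousOn_of_continuous
      (hd.continuousOn.mono hcl)) (ε / 3) (by positivity)
  obtain ⟨t, ht, htδ⟩ := exists_radius_near_one hδ
  have hmaps : MapsTo (fun z : ℂ => (t : ℂ) * z) (closedBall 0 1) (ball 0 1) := fun z hz => by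
    have hz : ‖z‖ ≤ 1 := by simpa using hz
    rw [mem_ball_zero_iff, norm_mul, norm_real, Real.norm_of_nonneg ht.1.le]
    nlinarith [ht.1, ht.2]
  obtain ⟨g, hgd, hgre, hgL, hgK⟩ := exists_holomorphic_exp_approx hKc hKs hK0
    (h := fun z => h (t * z) - (ε / 3 : ℝ))
    ((hd.comp (Differentiable.differentiableOn (by fun_prop)) hmaps).sub
      (differentiableOn_const _))
    (fun z hz => by
      have := hre _ (hmaps hz)
      simp only [sub_re, ofReal_re]
      linarith)
    (isCompact_closedBall 0 ρ) hcl hφ hφ1 (ε := ε / 3) (by positivity)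
  refine ⟨g, hgd.mono ball_subset_closedBall, fun z hz => (hgre z (ball_subset_closedBall hz)).le,
    fun z hz => ?_, fun δ' hδ' => ?_⟩
  · have hz1 : ‖z‖ ≤ ρ := by simpa using hz
    have htz : (t : ℂ) * z ∈ closedBall (0:ℂ) ρ := by
      rw [mem_closedBall_zero_iff, norm_mul, norm_real, Real.norm_of_nonneg ht.1.le]
      nlinarith [ht.1, ht.2, norm_nonneg z]
    have h1 := hδh _ htz z hz (by
      rw [dist_eq_norm]
      exact (norm_ofReal_mul_sub_le ht.2.le (hz1.trans hρ.le)).trans_lt (by linarith))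
    rw [dist_eq_norm] at h1
    have h2 := hgL z hz
    have h3 : g z - h z = (g z - (h (t * z) - (ε / 3 : ℝ))) + (h (t * z) - h z) - (ε / 3 : ℝ) := by
      ring
    rw [h3]
    refine (norm_sub_le _ _).trans_lt ?_
    rw [norm_real, Real.norm_of_nonneg (by positivity)]
    linarith [norm_add_le (g z - (h (t * z) - (ε / 3 : ℝ))) (h (t * z) - h z)]
  · obtain ⟨δ₁, hδ₁, hδg⟩ := Metric.uniformContinuousOn_iff.1
      ((isCompact_closedBall (0:ℂ) 1).uniformContinuousOn_of_continuous
        hgd.continuousOn) (ε / 3) (by positivity)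
    obtain ⟨r, hr, hrδ⟩ := exists_radius_near_one (lt_min hδ₁ hδ')
    refine ⟨r, hr, by linarith [min_le_right δ₁ δ'], fun z hz => ?_⟩
    have hz1 : ‖z‖ = 1 := by simpa using hKs hz
    have hzc : z ∈ closedBall (0:ℂ) 1 := sphere_subset_closedBall (hKs hz)
    have hrz : (r : ℂ) * z ∈ closedBall (0:ℂ) 1 := by
      rw [mem_closedBall_zero_iff, norm_mul, norm_real, Real.norm_of_nonneg hr.1.le, hz1, mul_one]
      exact hr.2.le
    have h1 := hδg _ hrz z hzc (by
      rw [dist_eq_norm]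
      exact (norm_ofReal_mul_sub_le hr.2.le hz1.le).trans_lt (by linarith [min_le_left δ₁ δ']))
    rw [dist_eq_norm] at h1
    have h2 := norm_exp_sub_exp_le (hgre _ hrz).le (hgre z hzc).le
    calc ‖exp (g (r * z)) - φ z‖ ≤ ‖exp (g (r * z)) - exp (g z)‖ + ‖exp (g z) - φ z‖ :=
          norm_sub_le_norm_sub_add_norm_sub _ _ _
      _ < ε := by linarith [hgK z hz]

theorem exists_log_of_zero_free {f : ℂ → ℂ} {c : ℂ} {R : ℝ} (hR : 0 < R)
    (hf : DifferentiableOn ℂ f (ball c R)) (hf0 : ∀ z ∈ ball c R, f z ≠ 0) :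
    ∃ h : ℂ → ℂ, DifferentiableOn ℂ h (ball c R) ∧ ∀ z ∈ ball c R, exp (h z) = f z := by
  have hc : c ∈ ball c R := mem_ball_self hR
  have hlog : DifferentiableOn ℂ (fun z => deriv f z / f z) (ball c R) :=
    (hf.deriv isOpen_ball).div hf hf0
  obtain ⟨h, hh⟩ := hlog.isExactOn_ball.with_val_at c (log (f c))
  have hhd : ∀ z ∈ ball c R, HasDerivAt h (deriv f z / f z) z := hh.2
  refine ⟨h, fun z hz => (hhd z hz).differentiableAt.differentiableWithinAt, fun z hz => ?_⟩
  have hder : ∀ w ∈ ball c R, HasDerivAt (fun w => f w * exp (-h w)) 0 w := fun w hw => by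
    have h1 := (hf.differentiableAt (isOpen_ball.mem_nhds hw)).hasDerivAt.mul (hhd w hw).neg.cexp
    have h2 : deriv f w * exp (-h w) + f w * (exp (-h w) * -(deriv f w / f w)) = 0 := by
      field_simp [hf0 w hw]
      ring
    exact h2 ▸ h1
  have hconst := (convex_ball c R).is_const_of_fderivWithin_eq_zero (𝕜 := ℂ)
    (f := fun w => f w * exp (-h w))
    (fun w hw => (hder w hw).differentiableAt.differentiableWithinAt)
    (fun w hw => by
      rw [fderivWithin_of_isOpen isOpen_ball hw, (hder w hw).hasFDerivAt.fderiv]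
      simp) hz hc
  have hval : h c = log (f c) := hh.1
  simp only [hval, exp_neg, exp_log (hf0 c hc), mul_inv_cancel₀ (hf0 c hc)] at hconst
  rw [← div_eq_mul_inv, div_eq_one_iff_eq (exp_ne_zero _)] at hconst
  exact hconst.symm

/-- Logarithms of the functions in `ZeroFreeBall`: holomorphic functions on the disc with
nonpositive real part. -/
def LogBall : Set (UniformOnFun ℂ ℂ discCompacts) :=
  {h | DifferentiableOn ℂ (UniformOnFun.toFun discCompacts h) (ball (0:ℂ) 1) ∧
       ∀ z ∈ ball (0:ℂ) 1, (UniformOnFun.toFun discCompacts h z).re ≤ 0}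

theorem closedBall_mem_discCompacts {ρ : ℝ} (hρ : ρ < 1) : closedBall (0:ℂ) ρ ∈ discCompacts :=
  ⟨closedBall_subset_ball hρ, isCompact_closedBall 0 ρ⟩

theorem exists_subset_closedBall_of_mem_discCompacts {S : Set ℂ} (hS : S ∈ discCompacts) :
    ∃ n : ℕ, S ⊆ closedBall (0:ℂ) (1 - 1 / ((n : ℝ) + 1)) := by
  obtain ⟨ρ, hρ, hSρ⟩ : ∃ ρ < 1, S ⊆ closedBall (0:ℂ) ρ := by
    rcases S.eq_empty_or_nonempty with rfl | hne
    · exact ⟨0, one_pos, empty_subset _⟩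
    · obtain ⟨z, hz, hmax⟩ := hS.2.exists_isMaxOn hne continuous_norm.continuousOn
      exact ⟨‖z‖, by simpa using hS.1 hz, fun w hw => by simpa using hmax hw⟩
  obtain ⟨n, hn⟩ := exists_nat_one_div_lt (sub_pos.2 hρ)
  exact ⟨n, hSρ.trans (closedBall_subset_closedBall (by linarith))⟩

theorem isCountablyGenerated_uniformity_discCompacts :
    (uniformity (UniformOnFun ℂ ℂ discCompacts)).IsCountablyGenerated :=
  UniformOnFun.isCountablyGenerated_uniformity discCompacts
    (t := fun n : ℕ => closedBall (0:ℂ) (1 - 1 / ((n : ℝ) + 1)))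
    (fun n => closedBall_mem_discCompacts (sub_lt_self 1 (by positivity)))
    (fun m n hmn => closedBall_subset_closedBall (by gcongr))
    (fun _ hS => exists_subset_closedBall_of_mem_discCompacts hS)

theorem isClosed_LogBall : IsClosed LogBall := by
  refine isClosed_iff_forall_filter.2 fun h u _ hu huh => ?_
  rw [← tendsto_id', UniformOnFun.tendsto_iff_tendstoUniformlyOn] at huh
  have hmem : ∀ᶠ g in u, g ∈ LogBall := hu (mem_principal_self _)
  refine ⟨?_, fun z hz => ?_⟩
  · refine TendstoLocallyUniformlyOn.differentiableOn (φ := u)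
      (F := UniformOnFun.toFun discCompacts) ?_ (hmem.mono fun g hg => hg.1) isOpen_ball
    exact (tendstoLocallyUniformlyOn_iff_forall_isCompact isOpen_ball).2
      fun S hS hSc => huh S ⟨hS, hSc⟩
  · have h1 := (huh {z} ⟨by simpa using hz, isCompact_singleton⟩).tendsto_at (mem_singleton z)
    exact le_of_tendsto ((continuous_re.tendsto _).comp h1) (hmem.mono fun g hg => hg.2 z hz)

theorem baireSpace_LogBall : BaireSpace LogBall := by
  have := isCountablyGenerated_uniformity_discCompacts
  have : CompleteSpace LogBall := isClosed_LogBall.isComplete.completeSpace_coe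
  have : (uniformity LogBall).IsCountablyGenerated := by
    rw [uniformity_subtype]
    infer_instance
  let _ := UniformSpace.pseudoMetricSpace LogBall
  infer_instance

/-- The exponential map from `LogBall` to `ZeroFreeBall`. -/
def expMap (h : LogBall) : ZeroFreeBall :=
  ⟨UniformOnFun.ofFun discCompacts fun z => exp (UniformOnFun.toFun discCompacts h.1 z),
    ⟨h.2.1.cexp, fun z hz => by
      simpa [norm_exp] using h.2.2 z hz⟩, fun _ _ => exp_ne_zero _⟩

theorem toFun_expMap (h : LogBall) (z : ℂ) :
    UniformOnFun.toFun discCompacts (expMap h).1 z =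
      exp (UniformOnFun.toFun discCompacts h.1 z) := rfl

theorem eventually_nhds_norm_sub_lt {T : Set (UniformOnFun ℂ ℂ discCompacts)} (f : T)
    {S : Set ℂ} (hS : S ∈ discCompacts) {ε : ℝ} (hε : 0 < ε) :
    ∀ᶠ g : T in nhds f, ∀ z ∈ S, ‖UniformOnFun.toFun discCompacts g.1 z -
      UniformOnFun.toFun discCompacts f.1 z‖ < ε := by
  have h1 := UniformOnFun.tendsto_iff_tendstoUniformlyOn.1
    ((continuous_subtype_val (p := (· ∈ T))).tendsto f) S hS
  refine (Metric.tendstoUniformlyOn_iff.1 h1 ε hε).mono fun g hg z hz => ?_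
  rw [← dist_eq_norm, dist_comm]
  exact hg z hz

theorem tendsto_nhds_of_forall_norm_sub_lt {ι : Type*} {p : Filter ι}
    {T : Set (UniformOnFun ℂ ℂ discCompacts)} {F : ι → T} {f : T}
    (h : ∀ S ∈ discCompacts, ∀ ε > 0, ∀ᶠ i in p, ∀ z ∈ S,
      ‖UniformOnFun.toFun discCompacts (F i).1 z - UniformOnFun.toFun discCompacts f.1 z‖ < ε) :
    Tendsto F p (nhds f) := by
  rw [tendsto_subtype_rng, UniformOnFun.tendsto_iff_tendstoUniformlyOn]
  refine fun S hS => Metric.tendstoUniformlyOn_iff.2 fun ε hε => (h S hS ε hε).mono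
    fun i hi z hz => ?_
  rw [dist_comm, dist_eq_norm]
  exact hi z hz

theorem continuous_expMap : Continuous expMap := by
  refine continuous_iff_continuousAt.2 fun h => tendsto_nhds_of_forall_norm_sub_lt
    fun S hS ε hε => (eventually_nhds_norm_sub_lt h hS hε).mono fun g hg z hz => ?_
  rw [toFun_expMap, toFun_expMap]
  exact (norm_exp_sub_exp_le (g.2.2 z (hS.1 hz)) (h.2.2 z (hS.1 hz))).trans_lt (hg z hz)

theorem denseRange_expMap : DenseRange expMap := by
  intro f
  obtain ⟨h, hd, hh⟩ := exists_log_of_zero_free one_pos f.2.1.1 f.2.2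
  have hre : ∀ z ∈ ball (0:ℂ) 1, (h z).re ≤ 0 := fun z hz => by
    have h1 := f.2.1.2 z hz
    rw [← hh z hz, norm_exp] at h1
    exact Real.exp_le_one_iff.1 h1
  let H : LogBall := ⟨UniformOnFun.ofFun discCompacts h, hd, hre⟩
  refine mem_closure_of_tendsto (b := (atTop : Filter ℕ)) (f := fun _ => expMap H) ?_
    (Eventually.of_forall fun _ => mem_range_self H)
  refine tendsto_nhds_of_forall_norm_sub_lt fun S hS ε hε => Eventually.of_forall fun _ z hz => ?_
  have : UniformOnFun.toFun discCompacts (expMap H).1 z = UniformOnFun.toFun discCompacts f.1 z :=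
    hh z (hS.1 hz)
  rw [this, sub_self, norm_zero]
  exact hε

/-- Functions of `ZeroFreeBall` some radial dilate of which, of radius within `ε` of `1`, is
uniformly `ε`-close to `φ` on `K`. -/
def radialApprox (K : Set ℂ) (φ : C(K, ℂ)) (ε : ℝ) : Set ZeroFreeBall :=
  {f | ∃ r ∈ Ioo (0:ℝ) 1, 1 - ε < r ∧
    ∀ z : K, ‖UniformOnFun.toFun discCompacts f.1 ((r : ℂ) * z) - φ z‖ < ε}

theorem ofReal_mul_mem_ball {K : Set ℂ} (hKs : K ⊆ sphere (0:ℂ) 1) {r : ℝ} (hr : r ∈ Ioo (0:ℝ) 1)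
    {z : ℂ} (hz : z ∈ K) : (r : ℂ) * z ∈ ball (0:ℂ) 1 := by
  have hz1 : ‖z‖ = 1 := by simpa using hKs hz
  rw [mem_ball_zero_iff, norm_mul, norm_real, Real.norm_of_nonneg hr.1.le, hz1, mul_one]
  exact hr.2

theorem isOpen_radialApprox {K : Set ℂ} (hKc : IsCompact K) (hKs : K ⊆ sphere (0:ℂ) 1)
    (φ : C(K, ℂ)) (ε : ℝ) : IsOpen (radialApprox K φ ε) := by
  refine isOpen_iff_mem_nhds.2 fun f hf => ?_
  obtain ⟨r, hr, hrε, hrK⟩ := hf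
  have : CompactSpace K := isCompact_iff_compactSpace.1 hKc
  have hcont : Continuous fun z : K =>
      ‖UniformOnFun.toFun discCompacts f.1 ((r : ℂ) * z) - φ z‖ := by
    refine ((f.2.1.1.continuousOn.comp_continuous (by fun_prop)
      fun z : K => ofReal_mul_mem_ball hKs hr z.2).sub φ.continuous).norm
  obtain ⟨m, hm, hmK⟩ : ∃ m < ε, ∀ z : K,
      ‖UniformOnFun.toFun discCompacts f.1 ((r : ℂ) * z) - φ z‖ ≤ m := by
    cases isEmpty_or_nonempty K with
    | inl h => exact ⟨ε - 1, by linarith, fun z => h.elim z⟩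
    | inr h =>
      obtain ⟨z, -, hz⟩ := isCompact_univ.exists_isMaxOn univ_nonempty hcont.continuousOn
      exact ⟨_, hrK z, fun w => hz (mem_univ w)⟩
  have hS : (fun z : ℂ => (r : ℂ) * z) '' K ∈ discCompacts :=
    ⟨image_subset_iff.2 fun z hz => ofReal_mul_mem_ball hKs hr hz,
      hKc.image (by fun_prop)⟩
  filter_upwards [eventually_nhds_norm_sub_lt f hS (sub_pos.2 hm)] with g hg
  refine ⟨r, hr, hrε, fun z => ?_⟩
  have h1 := hg _ (mem_image_of_mem _ z.2)
  refine (norm_sub_le_norm_sub_add_norm_sub _ _ _).trans_lt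
    (add_lt_add_of_lt_of_le h1 (hmK z)) |>.trans_eq (by ring)

theorem continuousOn_extend_val {K : Set ℂ} (φ : C(K, ℂ)) :
    ContinuousOn (Function.extend Subtype.val φ 0) K := by
  rw [continuousOn_iff_continuous_domRestrict]
  exact φ.continuous.congr fun z => (Subtype.val_injective.extend_apply φ 0 z).symm

theorem dense_preimage_radialApprox {K : Set ℂ} (hKc : IsCompact K) (hKs : K ⊆ sphere (0:ℂ) 1)
    (hK0 : arclength K = 0) (φ : C(K, ℂ)) (hφ : ∀ z, ‖φ z‖ ≤ 1) {ε : ℝ} (hε : 0 < ε) :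
    Dense (expMap ⁻¹' radialApprox K φ ε) := by
  intro h
  set ψ : ℂ → ℂ := Function.extend Subtype.val φ 0
  have hψφ : ∀ z : K, ψ z = φ z := fun z => Subtype.val_injective.extend_apply φ 0 z
  have hψc : ContinuousOn ψ K := continuousOn_extend_val φ
  have hψ1 : ∀ z ∈ K, ‖ψ z‖ ≤ 1 := fun z hz => by
    rw [hψφ ⟨z, hz⟩]
    exact hφ _
  have happ : ∀ n : ℕ, ∃ g : LogBall, expMap g ∈ radialApprox K φ ε ∧
      ∀ z ∈ closedBall (0:ℂ) (1 - 1 / ((n : ℝ) + 1)), ‖UniformOnFun.toFun discCompacts g.1 z -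
        UniformOnFun.toFun discCompacts h.1 z‖ < 1 / ((n : ℝ) + 1) := by
    intro n
    have hn : 0 < 1 / ((n : ℝ) + 1) := by positivity
    obtain ⟨g, hgd, hgre, hgh, hgr⟩ := exists_radial_exp_approx hKc hKs hK0 h.2.1 h.2.2
      (ρ := 1 - 1 / ((n : ℝ) + 1)) (by linarith) hψc hψ1 (lt_min hε hn)
    obtain ⟨r, hr, hrε, hrK⟩ := hgr ε hε
    refine ⟨⟨UniformOnFun.ofFun discCompacts g, hgd, hgre⟩, ⟨r, hr, hrε, fun z => ?_⟩,
      fun z hz => (hgh z hz).trans_le (min_le_right _ _)⟩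
    rw [← hψφ z]
    exact (hrK z z.2).trans_le (min_le_left _ _)
  choose g hg hgh using happ
  refine mem_closure_of_tendsto (b := (atTop : Filter ℕ)) (f := g) ?_ (Eventually.of_forall hg)
  refine tendsto_nhds_of_forall_norm_sub_lt fun S hS δ hδ => ?_
  obtain ⟨n, hn⟩ := exists_subset_closedBall_of_mem_discCompacts hS
  filter_upwards [eventually_ge_atTop n,
    tendsto_one_div_add_atTop_nhds_zero_nat.eventually_lt_const hδ] with k hk hkδ z hz
  refine (hgh k z (closedBall_subset_closedBall ?_ (hn hz))).trans hkδ
  gcongr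

theorem univClassS_eq_iInter {K : Set ℂ} (hKs : K ⊆ sphere (0:ℂ) 1)
    {D : Set C(K, ℂ)} (hD1 : ∀ φ ∈ D, ∀ z, ‖φ z‖ ≤ 1)
    (hD : ∀ φ : C(K, ℂ), (∀ z, ‖φ z‖ ≤ 1) → ∀ ε > 0, ∃ ψ ∈ D, ∀ z, ‖ψ z - φ z‖ < ε) :
    UnivClassS K = ⋂ φ ∈ D, ⋂ n : ℕ, radialApprox K φ (1 / ((n : ℝ) + 1)) := by
  ext f
  simp only [mem_iInter]
  constructor
  · intro hf φ hφ n
    have hφ1 := hD1 φ hφ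
    set ψ : ℂ → ℂ := Function.extend Subtype.val φ 0
    have hψφ : ∀ z : K, ψ z = φ z := fun z => Subtype.val_injective.extend_apply φ 0 z
    have hψc : ContinuousOn ψ K := continuousOn_extend_val φ
    have hψ1 : ∀ z ∈ K, ‖ψ z‖ ≤ 1 := fun z hz => by
      rw [hψφ ⟨z, hz⟩]
      exact hφ1 _
    obtain ⟨r, hr, hr1, hrt⟩ := hf ψ hψc hψ1
    have hn : 0 < 1 / ((n : ℝ) + 1) := by positivity
    obtain ⟨k, hk1, hk2⟩ := ((hr1.eventually_const_lt (by linarith : 1 - 1 / ((n : ℝ) + 1) < 1)).and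
      (hrt.eventually_lt_const hn)).exists
    refine ⟨r k, hr k, hk1, fun z => lt_of_le_of_lt ?_ hk2⟩
    have hb : ∀ w ∈ K, ‖UniformOnFun.toFun discCompacts f.1 ((r k : ℂ) * w) - ψ w‖ ≤ 2 :=
      fun w hw => (norm_sub_le _ _).trans (by
        linarith [f.2.1.2 _ (ofReal_mul_mem_ball hKs (hr k) hw), hψ1 w hw])
    rw [← hψφ z]
    refine le_trans ?_ (le_ciSup (f := fun w => ⨆ _ : w ∈ K,
      ‖UniformOnFun.toFun discCompacts f.1 ((r k : ℂ) * w) - ψ w‖) ⟨2, ?_⟩ (z : ℂ))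
    · rw [ciSup_pos z.2]
    · rintro _ ⟨w, rfl⟩
      exact Real.iSup_le (fun hw => hb w hw) (by norm_num)
  · intro hf φ hφ hφ1
    have : ∀ n : ℕ, ∃ r ∈ Ioo (0:ℝ) 1, 1 - 1 / ((n : ℝ) + 1) < r ∧ ∀ z ∈ K,
        ‖UniformOnFun.toFun discCompacts f.1 ((r : ℂ) * z) - φ z‖ ≤ 2 * (1 / ((n : ℝ) + 1)) := by
      intro n
      obtain ⟨ψ, hψD, hψ⟩ := hD ⟨K.domRestrict φ, hφ.domRestrict⟩ (fun z => hφ1 z z.2)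
        (1 / ((n : ℝ) + 1)) (by positivity)
      obtain ⟨r, hr, hr1, hrK⟩ := hf ψ hψD n
      refine ⟨r, hr, hr1, fun z hz => ?_⟩
      have h1 := hrK ⟨z, hz⟩
      have h2 : ‖ψ ⟨z, hz⟩ - φ z‖ < 1 / ((n : ℝ) + 1) := hψ ⟨z, hz⟩
      refine (norm_sub_le_norm_sub_add_norm_sub _ _ _).trans (add_le_add h1.le h2.le) |>.trans_eq
        (by ring)
    choose r hr hr1 hrK using this
    have hlim := tendsto_one_div_add_atTop_nhds_zero_nat (𝕜 := ℝ)
    refine ⟨r, hr, ?_, ?_⟩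
    · refine tendsto_of_tendsto_of_tendsto_of_le_of_le ?_ tendsto_const_nhds
        (fun n => (hr1 n).le) (fun n => (hr n).2.le)
      simpa using hlim.const_sub 1
    · refine squeeze_zero (fun n => Real.iSup_nonneg fun z => Real.iSup_nonneg fun _ =>
        norm_nonneg _) (fun n => ?_) (by simpa only [mul_zero] using hlim.const_mul 2)
      have h0 : 0 ≤ 2 * (1 / ((n : ℝ) + 1)) := by positivity
      exact Real.iSup_le (fun z => Real.iSup_le (fun hz => hrK n z hz) h0) h0

/-- The closed unit ball of `C(K, ℂ)` contains a countable dense subset. -/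
theorem exists_countable_dense_unitBall {K : Set ℂ} (hKc : IsCompact K) :
    ∃ D : Set C(K, ℂ), D.Countable ∧ (∀ φ ∈ D, ∀ z, ‖φ z‖ ≤ 1) ∧
      ∀ φ : C(K, ℂ), (∀ z, ‖φ z‖ ≤ 1) → ∀ ε > 0, ∃ ψ ∈ D, ∀ z, ‖ψ z - φ z‖ < ε := by
  have : CompactSpace K := isCompact_iff_compactSpace.1 hKc
  obtain ⟨D, hDB, hDc, hD⟩ := (TopologicalSpace.IsSeparable.of_separableSpace
    {φ : C(K, ℂ) | ∀ z, ‖φ z‖ ≤ 1}).exists_countable_dense_subset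
  refine ⟨D, hDc, fun φ hφ => hDB hφ, fun φ hφ ε hε => ?_⟩
  obtain ⟨ψ, hψ, hd⟩ := Metric.mem_closure_iff.1 (hD hφ) ε hε
  refine ⟨ψ, hψ, fun z => ?_⟩
  rw [← dist_eq_norm, dist_comm]
  exact (ContinuousMap.dist_apply_le_dist z).trans_lt hd

/-- For `K ⊆ 𝕋` compact of arclength measure 0, the radially universal functions form a dense
`G_δ` subset of the space `𝒮` of zero-free functions in the closed unit ball of `H^∞`. -/
theorem univClassS_denseGδ (K : Set ℂ) (hKc : IsCompact K)
    (hKs : K ⊆ Metric.sphere (0:ℂ) 1) (hK0 : arclength K = 0) :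
    IsGδ (UnivClassS K) ∧ Dense (UnivClassS K) := by
  obtain ⟨D, hDc, hD1, hD⟩ := exists_countable_dense_unitBall hKc
  have hopen := fun (φ : C(K, ℂ)) (n : ℕ) =>
    isOpen_radialApprox hKc hKs φ (1 / ((n : ℝ) + 1))
  rw [univClassS_eq_iInter hKs hD1 hD]
  refine ⟨IsGδ.biInter hDc fun φ _ => IsGδ.iInter_of_isOpen fun n => hopen φ n, ?_⟩
  have := baireSpace_LogBall
  have hdense : Dense (⋂ φ ∈ D, ⋂ n : ℕ, expMap ⁻¹' radialApprox K φ (1 / ((n : ℝ) + 1))) :=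
    dense_biInter_of_Gδ
      (fun φ _ => IsGδ.iInter_of_isOpen fun n => (hopen φ n).preimage continuous_expMap) hDc
      (fun φ hφ => dense_iInter_of_isOpen (fun n => (hopen φ n).preimage continuous_expMap)
        fun n => dense_preimage_radialApprox hKc hKs hK0 φ (hD1 φ hφ) (by positivity))
  refine (denseRange_expMap.dense_image continuous_expMap hdense).mono ?_
  rintro _ ⟨h, hh, rfl⟩
  simpa only [mem_iInter, mem_preimage] using hh
end
end
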